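/- arXiv:1610.07754 — 2 statements merged into one kernel-verified Lean document; each statement's English description precedes it below -/
import Mathlib

section
/- Assume T = Σ_{(u,v)∈E} A(u,v) > 0, and let ν be the probability distribution on E that picks edge (u,v) with probability A(u,v)/T, independently of g ∼ μ. Then for every seed set S ⊆ V: δ_A(S) = T · Pr_{g∼μ, (u,v)∼ν}[ S ∩ R_{g^T}(u) ≠ ∅ and S ∩ R_{g^T}(v) ≠ ∅ ]. -/
open scoped Classical
open Finset

noncomputable section

/-- The set of vertices reachable from the seed set `S` along edges of `g`. -/
def reach {V : Type*} [Fintype V] (g : Finset (V × V)) (S : Finset V) : Finset V :=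
  Finset.univ.filter fun v => ∃ u ∈ S, Relation.ReflTransGen (fun a b => (a, b) ∈ g) u v

/-- The transpose graph `g^T`: `(u,v) ∈ g` iff `(v,u) ∈ g^T`. -/
def transpose {V : Type*} (g : Finset (V × V)) : Finset (V × V) := g.image Prod.swap

/-- The activity `δ_A(S)` of a seed set `S`. -/
def deltaA {V : Type*} [Fintype V] (E : Finset (V × V)) (A : V × V → ℝ)
    (μ : Finset (V × V) → ℝ) (S : Finset V) : ℝ :=
  ∑ g ∈ E.powerset, μ g *
    ∑ e ∈ E.filter (fun e => e.1 ∈ reach g S ∧ e.2 ∈ reach g S), A e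

theorem mem_transpose {V : Type*} (g : Finset (V × V)) (a b : V) :
    (a, b) ∈ transpose g ↔ (b, a) ∈ g := by
  simp [transpose]

/-- `S` meets the reverse reachable set of `v` exactly when `v` is reachable from `S`. -/
theorem inter_reach_transpose_nonempty_iff {V : Type*} [Fintype V] (g : Finset (V × V))
    (S : Finset V) (v : V) :
    (S ∩ reach (transpose g) {v}).Nonempty ↔ v ∈ reach g S := by
  simp only [Finset.Nonempty, reach, mem_inter, mem_filter, mem_univ, true_and, mem_singleton,
    exists_eq_left, mem_transpose]
  exact exists_congr fun _ => and_congr_right fun _ => Relation.reflTransGen_swap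

/-- `δ_A(S) = T · Pr_{g∼μ,(u,v)∼ν}[S ∩ R_{g^T}(u) ≠ ∅ ∧ S ∩ R_{g^T}(v) ≠ ∅]`,
where `ν` picks edge `(u,v)` with probability `A(u,v)/T` and `T = Σ_{(u,v)∈E} A(u,v)`. -/
theorem deltaA_eq_T_mul_prob {V : Type*} [Fintype V]
    (E : Finset (V × V)) (A : V × V → ℝ) (μ : Finset (V × V) → ℝ)
    (hA : ∀ e ∈ E, 0 ≤ A e) (hA0 : ∀ e ∉ E, A e = 0)
    (hμ : ∀ g ∈ E.powerset, 0 ≤ μ g) (hμ1 : ∑ g ∈ E.powerset, μ g = 1)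
    (hT : 0 < ∑ e ∈ E, A e)
    (S : Finset V) :
    deltaA E A μ S = (∑ e ∈ E, A e) *
      ∑ g ∈ E.powerset, ∑ e ∈ E.filter (fun e =>
          (S ∩ reach (transpose g) {e.1}).Nonempty ∧
          (S ∩ reach (transpose g) {e.2}).Nonempty),
        μ g * (A e / ∑ e' ∈ E, A e') := by
  simp only [inter_reach_transpose_nonempty_iff, deltaA, mul_sum (a := ∑ e ∈ E, A e)]
  refine sum_congr rfl fun g _ => ?_
  rw [mul_sum]
  refine sum_congr rfl fun e _ => ?_
  field_simp
end
end

section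
/- (Correctness of the densest k-subgraph reduction.) Suppose the live-edge distribution μ is concentrated on the empty subgraph (so R_g(S) = S almost surely) and A(u,v) = 1 for every (u,v) ∈ E. Then for every S ⊆ V, δ_A(S) = |{(u,v) ∈ E : u ∈ S and v ∈ S}|; consequently, for any k ≥ 1, a k-element set S maximizes δ_A over all k-element sets if and only if S maximizes the density |{(u,v) ∈ E : u,v ∈ S}| / |S| over all k-element sets. -/
open scoped Classical
open Finset

noncomputable section

/-- Along the empty live-edge graph only the seeds are reachable. -/
theorem reach_empty {V : Type*} [Fintype V] (S : Finset V) : reach ∅ S = S := by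
  ext v
  simp only [reach, Finset.mem_filter, Finset.mem_univ, true_and]
  constructor
  · rintro ⟨u, hu, h⟩
    induction h with
    | refl => exact hu
    | tail _ h _ => simp at h
  · exact fun hv => ⟨v, hv, .refl⟩

/-- Correctness of the densest `k`-subgraph reduction: if the live-edge distribution is
concentrated on the empty subgraph and all activities on `E` equal `1`, then
`δ_A(S)` counts the edges inside `S`, and a `k`-set maximizes `δ_A` over `k`-sets iff
it maximizes the density over `k`-sets. -/
theorem densest_subgraph_reduction_correct {V : Type*} [Fintype V]
    (E : Finset (V × V)) (A : V × V → ℝ) (μ : Finset (V × V) → ℝ)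
    (hA1 : ∀ e ∈ E, A e = 1) (hA0 : ∀ e ∉ E, A e = 0)
    (hμ : μ ∅ = 1) (hμ0 : ∀ g ∈ E.powerset, g ≠ ∅ → μ g = 0) :
    (∀ S : Finset V,
      deltaA E A μ S = ((E.filter (fun e => e.1 ∈ S ∧ e.2 ∈ S)).card : ℝ)) ∧
    (∀ k : ℕ, 1 ≤ k → ∀ S : Finset V, S.card = k →
      ((∀ S' : Finset V, S'.card = k → deltaA E A μ S' ≤ deltaA E A μ S) ↔
        (∀ S' : Finset V, S'.card = k →
          ((E.filter (fun e => e.1 ∈ S' ∧ e.2 ∈ S')).card : ℝ) / (S'.card : ℝ) ≤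
          ((E.filter (fun e => e.1 ∈ S ∧ e.2 ∈ S)).card : ℝ) / (S.card : ℝ)))) := by
  have key : ∀ S : Finset V,
      deltaA E A μ S = ((E.filter (fun e => e.1 ∈ S ∧ e.2 ∈ S)).card : ℝ) := by
    intro S
    unfold deltaA
    rw [Finset.sum_eq_single_of_mem ∅ (Finset.empty_mem_powerset E)
      (fun g hg hne => by rw [hμ0 g hg hne, zero_mul]), hμ, one_mul, reach_empty,
      Finset.sum_congr rfl (fun e he => hA1 e (Finset.mem_filter.mp he).1)]
    simp
  refine ⟨key, fun k hk S hS => forall₂_congr fun S' hS' => ?_⟩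
  rw [key, key, hS, hS', div_le_div_iff_of_pos_right (by exact_mod_cast hk)]
end
end
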